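/- arXiv:1502.02413 — 2 statements merged into one kernel-verified Lean document; each statement's English description precedes it below -/
import Mathlib

section
/- Let G be a countable group, let ε ∈ (0,1), and let F be a finite subset of G containing the identity. Then there exists a set C ⊆ G such that the family {Fc : c ∈ C} is ε-disjoint (i.e., to each c ∈ C one can assign a subset T_c ⊆ Fc with |T_c| ≥ (1-ε)|F| such that the sets T_c, c ∈ C, are pairwise disjoint) and such that |FC ∩ Fg| ≥ ε|F| for every g ∈ G; in particular the lower Banach density of FC is at least ε. -/
open scoped Pointwise symmDiff Classical
open Filter

namespace AmenableTilings

variable {G : Type*}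

/-- The left translate `gF` of a finite set `F`. -/
noncomputable def lMul [Group G] (g : G) (F : Finset G) : Finset G := F.image (fun h => g * h)

/-- The right translate `Fg` of a finite set `F`. -/
noncomputable def rMul [Group G] (F : Finset G) (g : G) : Finset G := F.image (fun h => h * g)

/-- A Følner sequence: a sequence of finite nonempty sets with `|gFₙ Δ Fₙ|/|Fₙ| → 0`
for every `g`. -/
def IsFolnerSeq [Group G] (F : ℕ → Finset G) : Prop :=
  (∀ n, (F n).Nonempty) ∧
  ∀ g : G, Tendsto (fun n => (((lMul g (F n)) ∆ (F n)).card : ℝ) / ((F n).card : ℝ))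
    atTop (nhds 0)

/-- A group is amenable if it admits a Følner sequence. -/
def IsAmenable (G : Type*) [Group G] : Prop := ∃ F : ℕ → Finset G, IsFolnerSeq F

/-- `(K,ε)`-invariance: `|KT Δ T| < ε|T|`, where `KT = {gh : g ∈ K, h ∈ T}`. -/
def KInvariant [Group G] (K T : Finset G) (ε : ℝ) : Prop :=
  (((K * T) ∆ T).card : ℝ) < ε * (T.card : ℝ)

/-- `|S ∩ Fg|`. -/
noncomputable def interCard [Group G] (S : Set G) (F : Finset G) (g : G) : ℕ :=
  ((rMul F g).filter (fun h => h ∈ S)).card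

/-- `D̲_F(S) = inf_g |S ∩ Fg| / |F|`. -/
noncomputable def lowerD [Group G] (S : Set G) (F : Finset G) : ℝ :=
  ⨅ g : G, (interCard S F g : ℝ) / (F.card : ℝ)

/-- `D̄_F(S) = sup_g |S ∩ Fg| / |F|`. -/
noncomputable def upperD [Group G] (S : Set G) (F : Finset G) : ℝ :=
  ⨆ g : G, (interCard S F g : ℝ) / (F.card : ℝ)

/-- Lower Banach density: `sup { D̲_F(S) : F finite nonempty }`. -/
noncomputable def lowerBD [Group G] (S : Set G) : ℝ :=
  sSup {r : ℝ | ∃ F : Finset G, F.Nonempty ∧ r = lowerD S F}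

/-- Upper Banach density: `inf { D̄_F(S) : F finite nonempty }`. -/
noncomputable def upperBD [Group G] (S : Set G) : ℝ :=
  sInf {r : ℝ | ∃ F : Finset G, F.Nonempty ∧ r = upperD S F}

/-- The shift action of `G` on `Λ^G`: `(gx)(h) = x(hg)`. -/
def shift [Group G] {Λ : Type*} (g : G) (x : G → Λ) : G → Λ := fun h => x (h * g)

/-- The orbit closure of `x ∈ Λ^G` under the shift action (with `Λ` discrete and
`Λ^G` carrying the product topology). -/
noncomputable def orbitClosure [Group G] {Λ : Type*} (x : G → Λ) : Set (G → Λ) :=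
  @closure _ (@Pi.topologicalSpace G (fun _ => Λ) (fun _ => ⊥)) {y | ∃ g : G, y = shift g x}

/-- `N_X(F)`: the number of blocks with domain `F` occurring in `X`. -/
noncomputable def complexity [Group G] {Λ : Type*} (X : Set (G → Λ)) (F : Finset G) : ℕ :=
  Set.ncard ((fun x (f : {a // a ∈ F}) => x f.1) '' X)

/-- Topological entropy of a symbolic system:
`inf { (1/|F|) log₂ N_X(F) : F finite nonempty }`. -/
noncomputable def entropyOf [Group G] {Λ : Type*} (X : Set (G → Λ)) : ℝ :=
  sInf {r : ℝ | ∃ F : Finset G, F.Nonempty ∧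
    r = Real.logb 2 (complexity X F) / (F.card : ℝ)}

/-- The entropy of (the shift-orbit closure of) a symbolic element. -/
noncomputable def pointEntropy [Group G] {Λ : Type*} (x : G → Λ) : ℝ :=
  entropyOf (orbitClosure x)

/-- A quasitiling of `G`: finitely many finite shapes containing the identity,
with pairwise disjoint center sets, such that the map `(S,c) ↦ Sc` is injective. -/
structure Quasitiling (G : Type*) [Group G] where
  shapes : Finset (Finset G)
  centers : Finset G → Set G
  one_mem : ∀ S ∈ shapes, (1 : G) ∈ S
  centers_empty : ∀ S, S ∉ shapes → centers S = ∅
  centers_disjoint : ∀ S ∈ shapes, ∀ S' ∈ shapes, S ≠ S' → Disjoint (centers S) (centers S')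
  tiles_inj : ∀ S ∈ shapes, ∀ S' ∈ shapes, ∀ c ∈ centers S, ∀ c' ∈ centers S',
    rMul S c = rMul S' c' → S = S' ∧ c = c'

namespace Quasitiling

variable [Group G]

/-- `(S,c)` is a tile of the quasitiling. -/
def IsTile (𝒯 : Quasitiling G) (S : Finset G) (c : G) : Prop :=
  S ∈ 𝒯.shapes ∧ c ∈ 𝒯.centers S

/-- The union of all tiles of the quasitiling. -/
def union (𝒯 : Quasitiling G) : Set G :=
  ⋃ S ∈ 𝒯.shapes, ⋃ c ∈ 𝒯.centers S, (↑(rMul S c) : Set G)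

/-- `f` witnesses `ε`-disjointness: it assigns to each tile a `(1-ε)`-subset, and the
assigned subsets of distinct tiles are pairwise disjoint. -/
def EpsDisjointWith (𝒯 : Quasitiling G) (ε : ℝ) (f : Finset G → G → Finset G) : Prop :=
  (∀ S c, 𝒯.IsTile S c →
    f S c ⊆ rMul S c ∧ (1 - ε) * (S.card : ℝ) ≤ ((f S c).card : ℝ)) ∧
  (∀ S c S' c', 𝒯.IsTile S c → 𝒯.IsTile S' c' → (S, c) ≠ (S', c') →
    Disjoint (f S c) (f S' c'))

/-- `ε`-disjointness of a quasitiling. -/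
def EpsDisjoint (𝒯 : Quasitiling G) (ε : ℝ) : Prop := ∃ f, 𝒯.EpsDisjointWith ε f

/-- The tiles are pairwise disjoint. -/
def TilesDisjoint (𝒯 : Quasitiling G) : Prop :=
  ∀ S c S' c', 𝒯.IsTile S c → 𝒯.IsTile S' c' → (S, c) ≠ (S', c') →
    Disjoint (rMul S c) (rMul S' c')

/-- `α`-covering: the union of the tiles has lower Banach density at least `α`. -/
def Covering (𝒯 : Quasitiling G) (α : ℝ) : Prop := α ≤ lowerBD 𝒯.union

/-- An exact tiling: the tiles form a partition of `G`. -/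
def IsExactTiling (𝒯 : Quasitiling G) : Prop := 𝒯.TilesDisjoint ∧ 𝒯.union = Set.univ

/-- The symbolic representation `x_𝒯` of a quasitiling, over the alphabet
`𝒮(𝒯) ∪ {0}` (encoded as `Option (Finset G)`, with `none` playing the role of `0`):
`x_𝒯(g) = S` iff `g ∈ C(S)`. -/
noncomputable def symb (𝒯 : Quasitiling G) : G → Option (Finset G) :=
  fun g => if h : ∃ S, S ∈ 𝒯.shapes ∧ g ∈ 𝒯.centers S then some h.choose else none

/-- The entropy of a quasitiling: the topological entropy of the shift-orbit closure of
its symbolic representation. -/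
noncomputable def entropy (𝒯 : Quasitiling G) : ℝ := pointEntropy 𝒯.symb

end Quasitiling

/-- `𝒯'` is congruent with `𝒯` (each tile of `𝒯'` is a union of tiles of `𝒯`). -/
def Congruent [Group G] (𝒯 𝒯' : Quasitiling G) : Prop :=
  ∀ S c, 𝒯'.IsTile S c → ∃ P : Set (Finset G × G),
    (∀ p ∈ P, 𝒯.IsTile p.1 p.2) ∧
    (↑(rMul S c) : Set G) = ⋃ p ∈ P, (↑(rMul p.1 p.2) : Set G)

/-- The union over all tiles `(S,c)` of the assigned subsets `f S c`. -/
def subUnion [Group G] (𝒯 : Quasitiling G) (f : Finset G → G → Finset G) : Set G :=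
  ⋃ S ∈ 𝒯.shapes, ⋃ c ∈ 𝒯.centers S, (↑(f S c) : Set G)

end AmenableTilings
namespace AmenableTilings

theorem card_rMul {G : Type*} [Group G] (F : Finset G) (g : G) : (rMul F g).card = F.card :=
  Finset.card_image_of_injective _ (mul_left_injective g)

theorem interCard_le_card {G : Type*} [Group G] (S : Set G) (F : Finset G) (g : G) :
    interCard S F g ≤ F.card :=
  (Finset.card_filter_le _ _).trans (card_rMul F g).le

theorem interCard_eq_card_of_subset {G : Type*} [Group G] {S : Set G} {F : Finset G} {g : G}
    (h : (↑(rMul F g) : Set G) ⊆ S) : interCard S F g = F.card := by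
  rw [interCard, Finset.filter_true_of_mem fun x hx => h hx, card_rMul]

theorem lowerD_le_one {G : Type*} [Group G] (S : Set G) (F : Finset G) : lowerD S F ≤ 1 := by
  have hbdd : BddBelow (Set.range fun g : G => (interCard S F g : ℝ) / (F.card : ℝ)) :=
    ⟨0, by rintro _ ⟨g, rfl⟩; positivity⟩
  refine (ciInf_le hbdd 1).trans (div_le_one_of_le₀ ?_ (Nat.cast_nonneg _))
  exact_mod_cast interCard_le_card S F 1

theorem lowerD_le_lowerBD {G : Type*} [Group G] (S : Set G) {F : Finset G} (hF : F.Nonempty) :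
    lowerD S F ≤ lowerBD S :=
  le_csSup ⟨1, by rintro _ ⟨F', -, rfl⟩; exact lowerD_le_one S F'⟩ ⟨F, hF, rfl⟩

theorem le_lowerBD_of_forall_le_interCard {G : Type*} [Group G] {S : Set G} {F : Finset G}
    (hF : F.Nonempty) {ε : ℝ} (h : ∀ g : G, ε * (F.card : ℝ) ≤ (interCard S F g : ℝ)) :
    ε ≤ lowerBD S := by
  have hpos : (0 : ℝ) < F.card := by exact_mod_cast hF.card_pos
  exact (le_ciInf fun g => (le_div_iff₀ hpos).2 (h g)).trans (lowerD_le_lowerBD S hF)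

/-- A maximal set of pairs `(c, t)` with `t` a large subset of `Fc`, with distinct centers and
disjoint subsets. -/
theorem exists_maximal_assignment {G : Type*} [Group G] (ε : ℝ) (F : Finset G) :
    ∃ P : Set (G × Finset G), Maximal (fun P : Set (G × Finset G) =>
      (∀ p ∈ P, p.2 ⊆ rMul F p.1 ∧ (1 - ε) * (F.card : ℝ) ≤ (p.2.card : ℝ)) ∧
      P.Pairwise fun p q => p.1 ≠ q.1 ∧ Disjoint p.2 q.2) P := by
  refine zorn_subset {P : Set (G × Finset G) | _} fun c hc hchain => ⟨⋃₀ c, ⟨?_, ?_⟩,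
    fun s hs => Set.subset_sUnion_of_mem hs⟩
  · rintro p ⟨s, hs, hp⟩
    exact (hc hs).1 p hp
  · exact (Set.pairwise_sUnion hchain.directedOn).2 fun s hs => (hc hs).2

/-- for a finite set `F ∋ 1` and `ε ∈ (0,1)`, there exists `C ⊆ G` such
that the family `{Fc : c ∈ C}` is `ε`-disjoint and `|FC ∩ Fg| ≥ ε|F|` for every `g`;
in particular the lower Banach density of `FC` is at least `ε`. -/
theorem statement10 {G : Type*} [Group G] [Countable G]
    (ε : ℝ) (hε : ε ∈ Set.Ioo (0 : ℝ) 1) (F : Finset G) (h1 : (1 : G) ∈ F) :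
    ∃ C : Set G,
      (∃ T : G → Finset G,
        (∀ c ∈ C, T c ⊆ rMul F c ∧ (1 - ε) * (F.card : ℝ) ≤ ((T c).card : ℝ)) ∧
        (∀ c ∈ C, ∀ c' ∈ C, c ≠ c' → Disjoint (T c) (T c'))) ∧
      (∀ g : G,
        ε * (F.card : ℝ) ≤ (interCard (⋃ c ∈ C, (↑(rMul F c) : Set G)) F g : ℝ)) ∧
      ε ≤ lowerBD (⋃ c ∈ C, (↑(rMul F c) : Set G)) := by
  obtain ⟨P, ⟨hsub, hpair⟩, hmax⟩ := exists_maximal_assignment ε F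
  have hT : ∀ c, ∃ t, c ∈ Prod.fst '' P → (c, t) ∈ P := by
    intro c
    by_cases hc : c ∈ Prod.fst '' P
    · obtain ⟨p, hp, rfl⟩ := hc
      exact ⟨p.2, fun _ => hp⟩
    · exact ⟨∅, fun h => absurd h hc⟩
  choose T hT using hT
  set S : Set G := ⋃ c ∈ Prod.fst '' P, (↑(rMul F c) : Set G)
  have htile : ∀ c ∈ Prod.fst '' P, (↑(rMul F c) : Set G) ⊆ S := fun c hc =>
    Set.subset_biUnion_of_mem (u := fun c => (↑(rMul F c) : Set G)) hc
  have hcover : ∀ g : G, ε * (F.card : ℝ) ≤ (interCard S F g : ℝ) := by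
    intro g
    by_cases hg : g ∈ Prod.fst '' P
    · rw [interCard_eq_card_of_subset (htile g hg)]
      exact mul_le_of_le_one_left (Nat.cast_nonneg _) hε.2.le
    by_contra! hlt
    set t : Finset G := (rMul F g).filter (fun h => h ∉ S)
    have hcard : interCard S F g + t.card = F.card := by
      rw [← card_rMul F g]
      exact Finset.card_filter_add_card_filter_not _
    have hcard' : (interCard S F g : ℝ) + t.card = F.card := by exact_mod_cast hcard
    have hdisj : ∀ p ∈ P, g ≠ p.1 ∧ Disjoint t p.2 := by
      intro p hp
      refine ⟨fun h => hg ⟨p, hp, h.symm⟩, Finset.disjoint_left.2 fun x hx hxp => ?_⟩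
      exact (Finset.mem_filter.1 hx).2 (htile p.1 ⟨p, hp, rfl⟩ ((hsub p hp).1 hxp))
    have hmem : (g, t) ∈ P := by
      refine hmax ⟨?_, ?_⟩ (Set.subset_insert (g, t) P) (Set.mem_insert _ _)
      · rintro p (rfl | hp)
        · exact ⟨Finset.filter_subset _ _, by dsimp only; linarith⟩
        · exact hsub p hp
      · exact hpair.insert fun p hp _ =>
          ⟨hdisj p hp, (hdisj p hp).1.symm, (hdisj p hp).2.symm⟩
    exact hg ⟨_, hmem, rfl⟩
  refine ⟨Prod.fst '' P, ⟨T, fun c hc => hsub _ (hT c hc), fun c hc c' hc' hne => ?_⟩, hcover,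
    le_lowerBD_of_forall_le_interCard ⟨1, h1⟩ hcover⟩
  exact (hpair (hT c hc) (hT c' hc') fun h => hne (congrArg Prod.fst h)).2

end AmenableTilings
end

section
/- Let G be an infinite countable amenable group and let g ∈ G be an element of infinite order. Then there exists a nonempty closed shift-invariant set X ⊆ {-1,1}^G with topological entropy zero such that gy ≠ y for every y ∈ X. Explicitly, choosing a set B ⊆ G containing exactly one element of each right coset of the cyclic group generated by g (so every h ∈ G has a unique representation h = g^{p(h)} b with p(h) ∈ ℤ, b ∈ B), the shift-orbit closure of the element x ∈ {-1,1}^G defined by x(h) = (-1)^{p(h)} is such a set. -/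
open scoped Pointwise symmDiff Classical
open Filter

namespace AmenableTilings

theorem logb_two_natCast_nonneg (n : ℕ) : 0 ≤ Real.logb 2 n :=
  div_nonneg (Real.log_natCast_nonneg n) (Real.log_nonneg one_le_two)

theorem shift_mem_orbitClosure {G : Type*} [Group G] {Λ : Type*} {x y : G → Λ}
    (hy : y ∈ orbitClosure x) (k : G) : shift k y ∈ orbitClosure x := by
  let : TopologicalSpace Λ := ⊥
  have hc : Continuous (shift k : (G → Λ) → G → Λ) :=
    continuous_pi fun h => continuous_apply (h * k)
  refine map_mem_closure hc hy ?_
  rintro _ ⟨l, rfl⟩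
  exact ⟨k * l, by funext h; simp [shift, mul_assoc]⟩

/-- A relation between the values at `g * h` and `h`, valid for all `h`, passes from `x` to its
orbit closure. -/
theorem apply_mul_of_mem_orbitClosure {G : Type*} [Group G] {Λ : Type*} {x y : G → Λ}
    {g : G} {f : Λ → Λ} (hx : ∀ h, x (g * h) = f (x h)) (hy : y ∈ orbitClosure x) (h : G) :
    y (g * h) = f (y h) := by
  let : TopologicalSpace Λ := ⊥
  have : DiscreteTopology Λ := ⟨rfl⟩
  have hcl : IsClosed {z : G → Λ | z (g * h) = f (z h)} :=
    isClosed_eq (continuous_apply _) (continuous_of_discreteTopology.comp (continuous_apply h))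
  refine closure_minimal ?_ hcl hy
  rintro _ ⟨k, rfl⟩
  simp [shift, mul_assoc, hx]

theorem entropyOf_nonneg {G : Type*} [Group G] {Λ : Type*} (X : Set (G → Λ)) : 0 ≤ entropyOf X := by
  refine Real.sInf_nonneg ?_
  rintro _ ⟨F, -, rfl⟩
  exact div_nonneg (logb_two_natCast_nonneg _) (Nat.cast_nonneg _)

theorem entropyOf_le {G : Type*} [Group G] {Λ : Type*} (X : Set (G → Λ)) {F : Finset G} (hF : F.Nonempty) :
    entropyOf X ≤ Real.logb 2 (complexity X F) / (F.card : ℝ) := by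
  refine csInf_le ⟨0, ?_⟩ ⟨F, hF, rfl⟩
  rintro _ ⟨F, -, rfl⟩
  exact div_nonneg (logb_two_natCast_nonneg _) (Nat.cast_nonneg _)

/-- If the value at `1` determines the values on all powers of an element of infinite order, then
the entropy vanishes. -/
theorem entropyOf_eq_zero_of_apply_mul {G : Type*} [Group G] {Λ : Type*} [Finite Λ] {X : Set (G → Λ)}
    {g : G} (hg : ¬ IsOfFinOrder g) {f : Λ → Λ} (hX : ∀ y ∈ X, ∀ h, y (g * h) = f (y h)) :
    entropyOf X = 0 := by
  have hpow : ∀ y ∈ X, ∀ n : ℕ, y (g ^ n) = f^[n] (y 1) := by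
    intro y hy n
    induction n with
    | zero => simp
    | succ n ih => rw [pow_succ', hX y hy, ih, Function.iterate_succ_apply']
  have hinj : Function.Injective fun n : ℕ => g ^ n := injective_pow_iff_not_isOfFinOrder.2 hg
  have hbound (n : ℕ) : entropyOf X ≤ Real.logb 2 (Nat.card Λ) / ((n : ℝ) + 1) := by
    set F : Finset G := (Finset.range (n + 1)).image fun n => g ^ n with hF
    have hcard : F.card = n + 1 := by
      rw [hF, Finset.card_image_of_injective _ hinj, Finset.card_range]
    have hne : F.Nonempty := Finset.card_pos.1 (by omega)
    have hcompl : complexity X F ≤ Nat.card Λ := by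
      have h1 : (1 : G) ∈ F := Finset.mem_image.2 ⟨0, by simp, pow_zero g⟩
      rw [complexity, ← Set.ncard_univ]
      refine Set.ncard_le_ncard_of_injOn (fun w => w ⟨1, h1⟩) (fun _ _ => Set.mem_univ _) ?_
        Set.finite_univ
      rintro _ ⟨y, hy, rfl⟩ _ ⟨z, hz, rfl⟩ hyz
      funext ⟨a, ha⟩
      obtain ⟨m, -, rfl⟩ := Finset.mem_image.1 ha
      change y 1 = z 1 at hyz
      change y (g ^ m) = z (g ^ m)
      rw [hpow y hy, hpow z hz, hyz]
    have hlog : Real.logb 2 (complexity X F) ≤ Real.logb 2 (Nat.card Λ) := by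
      rcases Nat.eq_zero_or_pos (complexity X F) with h0 | h0
      · rw [h0, Nat.cast_zero, Real.logb_zero]
        exact logb_two_natCast_nonneg _
      · exact Real.logb_le_logb_of_le one_lt_two (by exact_mod_cast h0) (by exact_mod_cast hcompl)
    refine (entropyOf_le X hne).trans ?_
    rw [hcard, Nat.cast_succ]
    gcongr
  have hlim : Tendsto (fun n : ℕ => Real.logb 2 (Nat.card Λ) / ((n : ℝ) + 1)) atTop (nhds 0) := by
    simpa [div_eq_mul_inv] using
      (tendsto_one_div_add_atTop_nhds_zero_nat (𝕜 := ℝ)).const_mul (Real.logb 2 (Nat.card Λ))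
  exact le_antisymm (ge_of_tendsto' hlim hbound) (entropyOf_nonneg X)

/-- for an element `g` of infinite order, choosing a transversal `B` of the
right cosets of `⟨g⟩` (so each `h` has a unique representation `h = g^(p h) * b h` with
`b h ∈ B`), the shift-orbit closure of `x(h) = (-1)^(p h)` (with alphabet `{-1,1} = ℤˣ`)
is a nonempty closed shift-invariant set with topological entropy zero on which the shift
by `g` has no fixed points. -/
theorem statement17 {G : Type*} [Group G] [Countable G] [Infinite G] (hG : IsAmenable G)
    (g : G) (hg : ¬ IsOfFinOrder g)
    (B : Set G) (p : G → ℤ) (b : G → G)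
    (hrep : ∀ h : G, b h ∈ B ∧ h = g ^ (p h) * b h)
    (huniq : ∀ h : G, ∀ q : ℤ, ∀ a ∈ B, h = g ^ q * a → q = p h ∧ a = b h) :
    (orbitClosure (fun h : G => ((-1 : ℤˣ) ^ (p h)))).Nonempty ∧
    (@IsClosed (G → ℤˣ) (@Pi.topologicalSpace G (fun _ => ℤˣ) (fun _ => ⊥))
      (orbitClosure (fun h : G => ((-1 : ℤˣ) ^ (p h))))) ∧
    (∀ y ∈ orbitClosure (fun h : G => ((-1 : ℤˣ) ^ (p h))), ∀ g' : G,
      shift g' y ∈ orbitClosure (fun h : G => ((-1 : ℤˣ) ^ (p h)))) ∧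
    pointEntropy (fun h : G => ((-1 : ℤˣ) ^ (p h))) = 0 ∧
    (∀ y ∈ orbitClosure (fun h : G => ((-1 : ℤˣ) ^ (p h))), shift g y ≠ y) := by
  have hx (h : G) : (-1 : ℤˣ) ^ p (g * h) = -(-1 : ℤˣ) ^ p h := by
    have hp : g * h = g ^ (p h + 1) * b h := by
      conv_lhs => rw [(hrep h).2]
      rw [← mul_assoc, add_comm, zpow_add, zpow_one]
    rw [← (huniq (g * h) (p h + 1) (b h) (hrep h).1 hp).1, zpow_add, zpow_one, mul_neg_one]
  have hneg := fun y hy =>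
    apply_mul_of_mem_orbitClosure (x := fun h : G => (-1 : ℤˣ) ^ p h) (y := y) (f := Neg.neg) hx hy
  refine ⟨?_, ?_, fun y hy g' => shift_mem_orbitClosure hy g',
    entropyOf_eq_zero_of_apply_mul hg hneg, fun y hy hfix => ?_⟩
  · let : TopologicalSpace ℤˣ := ⊥
    exact ⟨_, subset_closure ⟨1, rfl⟩⟩
  · let : TopologicalSpace ℤˣ := ⊥
    exact isClosed_closure
  · have h1 : y g = y 1 := by simpa [shift] using congrFun hfix 1
    have h2 : y g = -y 1 := by simpa using hneg y hy 1
    exact units_ne_neg_self (y 1) (h1.symm.trans h2)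

end AmenableTilings
end
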